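/- Let n = 2^c + 2^b + 2^a where c > b > a ≥ 0, and let s be an odd positive integer that divides each of the three binomial coefficients C(n, 2^a), C(n, 2^b), and C(n, 2^c). Suppose further that there exists an integer k with 1 ≤ k ≤ n−1 and k ∉ {2^a, 2^b, 2^a+2^b, 2^c, 2^c+2^a, 2^c+2^b} such that s divides C(n, k). Then the cyclotomic polynomial Φ_{2s}(t) divides the descent set polynomial Q_n(t). -/

import Mathlib

/-- The descent set of a permutation of `Fin n`, as a subset of `[n-1] = {1,…,n-1}`
(1-based positions): `i` is a descent if `π(i) > π(i+1)`. -/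
def descentSet (n : ℕ) (π : Equiv.Perm (Fin n)) : Finset ℕ :=
  (Finset.Ico 1 n).filter fun i => ∀ h : i < n, π ⟨i, h⟩ < π ⟨i - 1, by omega⟩

/-- The descent set statistic `β_n(S)`: the number of permutations of `{1,…,n}`
with descent set `S`. -/
def beta (n : ℕ) (S : Finset ℕ) : ℕ :=
  (Finset.univ.filter fun π : Equiv.Perm (Fin n) => descentSet n π = S).card

/-- The descent set polynomial `Q_n(t) = ∑_{S ⊆ [n-1]} t^{β_n(S)}`. -/
noncomputable def Q (n : ℕ) : Polynomial ℤ :=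
  ∑ S ∈ (Finset.Ico 1 n).powerset, Polynomial.X ^ beta n S

section

open Finset Polynomial

theorem mem_descentSet {n : ℕ} {π : Equiv.Perm (Fin n)} {i : ℕ} (hi : 1 ≤ i) (h : i < n) :
    i ∈ descentSet n π ↔ π ⟨i, h⟩ < π ⟨i - 1, by omega⟩ := by
  simp [descentSet, hi, h]

theorem descentSet_subset (n : ℕ) (π : Equiv.Perm (Fin n)) : descentSet n π ⊆ Ico 1 n :=
  filter_subset _ _

theorem beta_empty (n : ℕ) : beta n ∅ = 1 := by
  rw [beta, card_eq_one]
  refine ⟨1, ?_⟩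
  ext π
  simp only [mem_filter, mem_univ, true_and, mem_singleton]
  constructor
  · intro h
    have hmono : StrictMono π := by
      cases n with
      | zero => exact fun i => i.elim0
      | succ n =>
        refine Fin.strictMono_iff_lt_succ.2 fun i => ?_
        have h1 : (i : ℕ) + 1 ∉ descentSet (n + 1) π := by simp [h]
        rw [mem_descentSet (by omega) (by omega), not_lt] at h1
        refine lt_of_le_of_ne h1 fun h2 => ?_
        have := congrArg Fin.val (π.injective h2)
        simp at this
    have h3 : hmono.orderIsoOfSurjective π π.surjective = OrderIso.refl _ :=
      Subsingleton.elim _ _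
    ext x
    exact congrArg Fin.val (congrArg (fun e : Fin n ≃o Fin n => e x) h3)
  · rintro rfl
    rw [eq_empty_iff_forall_notMem]
    intro i hi
    obtain ⟨h1, h2⟩ := mem_Ico.1 (descentSet_subset _ _ hi)
    rw [mem_descentSet h1 h2] at hi
    simp only [Equiv.Perm.coe_one, id_eq, Fin.mk_lt_mk] at hi
    omega

/-- The permutation of `Fin (k + m)` that maps the first `k` positions onto `A` in the relative
order `σ`, and the last `m` positions onto the complement of `A` in the relative order `τ`. -/
def shufflePerm {k m : ℕ} (p : {A : Finset (Fin (k + m)) // A.card = k} ×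
    Equiv.Perm (Fin k) × Equiv.Perm (Fin m)) : Equiv.Perm (Fin (k + m)) :=
  finSumFinEquiv.symm.trans ((Equiv.sumCongr p.2.1 p.2.2).trans
    (finSumEquivOfFinset p.1.2 (by rw [card_compl, p.1.2, Fintype.card_fin]; omega)))

theorem shufflePerm_castAdd {k m : ℕ} (p : {A : Finset (Fin (k + m)) // A.card = k} ×
    Equiv.Perm (Fin k) × Equiv.Perm (Fin m)) (i : Fin k) :
    shufflePerm p (Fin.castAdd m i) = p.1.1.orderEmbOfFin p.1.2 (p.2.1 i) := by
  simp [shufflePerm]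

theorem shufflePerm_natAdd {k m : ℕ} (p : {A : Finset (Fin (k + m)) // A.card = k} ×
    Equiv.Perm (Fin k) × Equiv.Perm (Fin m)) (i : Fin m) :
    shufflePerm p (Fin.natAdd k i) = p.1.1ᶜ.orderEmbOfFin
      (by rw [card_compl, p.1.2, Fintype.card_fin]; omega) (p.2.2 i) := by
  simp [shufflePerm]

theorem shufflePerm_bijective (k m : ℕ) : Function.Bijective (@shufflePerm k m) := by
  rw [Fintype.bijective_iff_injective_and_card]
  constructor
  · rintro ⟨⟨A, hA⟩, σ, τ⟩ ⟨⟨B, hB⟩, σ', τ'⟩ h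
    have himg : ∀ p : {A : Finset (Fin (k + m)) // A.card = k} ×
        Equiv.Perm (Fin k) × Equiv.Perm (Fin m),
        (p.1.1 : Set (Fin (k + m))) = Set.range fun i => shufflePerm p (Fin.castAdd m i) := by
      intro p
      simp only [shufflePerm_castAdd]
      rw [← range_orderEmbOfFin p.1.1 p.1.2]
      exact (p.2.1.surjective.range_comp _).symm
    have hAB : A = B := by
      have h1 := himg ⟨⟨A, hA⟩, σ, τ⟩
      rw [h, ← himg] at h1
      exact coe_injective h1
    subst hAB
    congr 2
    · ext i
      have := congrArg (fun e => e (Fin.castAdd m i)) h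
      simp only [shufflePerm_castAdd] at this
      exact congrArg Fin.val ((orderEmbOfFin A hA).injective this)
    · ext i
      have := congrArg (fun e => e (Fin.natAdd k i)) h
      simp only [shufflePerm_natAdd] at this
      exact congrArg Fin.val ((orderEmbOfFin _ _).injective this)
  · simp only [Fintype.card_prod, Fintype.card_perm, Fintype.card_finset_len, Fintype.card_fin]
    rw [← mul_assoc, ← Nat.choose_mul_factorial_mul_factorial (Nat.le_add_right k m), Nat.add_sub_cancel_left]

theorem mem_descentSet_shufflePerm_left {k m : ℕ} (p : {A : Finset (Fin (k + m)) // A.card = k} ×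
    Equiv.Perm (Fin k) × Equiv.Perm (Fin m)) {i : ℕ} (hi : 1 ≤ i) (hik : i < k) :
    i ∈ descentSet (k + m) (shufflePerm p) ↔ i ∈ descentSet k p.2.1 := by
  rw [mem_descentSet hi (by omega), mem_descentSet hi hik]
  have h1 := shufflePerm_castAdd p ⟨i, hik⟩
  have h2 := shufflePerm_castAdd p ⟨i - 1, by omega⟩
  simp only [Fin.castAdd_mk] at h1 h2
  rw [h1, h2, OrderEmbedding.lt_iff_lt]

theorem mem_descentSet_shufflePerm_right {k m : ℕ} (p : {A : Finset (Fin (k + m)) // A.card = k} ×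
    Equiv.Perm (Fin k) × Equiv.Perm (Fin m)) {i : ℕ} (hi : 1 ≤ i) (him : i < m) :
    k + i ∈ descentSet (k + m) (shufflePerm p) ↔ i ∈ descentSet m p.2.2 := by
  rw [mem_descentSet (by omega) (by omega), mem_descentSet hi him]
  have h1 := shufflePerm_natAdd p ⟨i, him⟩
  have h2 := shufflePerm_natAdd p ⟨i - 1, by omega⟩
  simp only [Fin.natAdd_mk] at h1 h2
  have h3 : (⟨k + i - 1, by omega⟩ : Fin (k + m)) = ⟨k + (i - 1), by omega⟩ := by
    ext; simp; omega
  rw [h1, h3, h2, OrderEmbedding.lt_iff_lt]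

/-- Prescribing the descents everywhere except at `k` counts pairs of shorter permutations
together with a choice of the first `k` values. -/
theorem beta_add_beta_symmDiff {k m : ℕ} (hk : 0 < k) {S : Finset ℕ}
    (hS : S ⊆ Ico 1 (k + m)) :
    beta (k + m) S + beta (k + m) (symmDiff S {k}) =
      (k + m).choose k * (beta k {i ∈ Ico 1 k | i ∈ S} * beta m {i ∈ Ico 1 m | k + i ∈ S}) := by
  have hne : symmDiff S {k} ≠ S := by
    intro h
    have := symmDiff_eq_left.1 h
    simp at this
  have hkey : ∀ p : {A : Finset (Fin (k + m)) // A.card = k} ×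
      Equiv.Perm (Fin k) × Equiv.Perm (Fin m),
      (descentSet (k + m) (shufflePerm p) = S ∨
        descentSet (k + m) (shufflePerm p) = symmDiff S {k}) ↔
      descentSet k p.2.1 = {i ∈ Ico 1 k | i ∈ S} ∧
        descentSet m p.2.2 = {i ∈ Ico 1 m | k + i ∈ S} := by
    intro p
    set D := descentSet (k + m) (shufflePerm p) with hD
    have h1 : (D = S ∨ D = symmDiff S {k}) ↔ ∀ i ≠ k, (i ∈ D ↔ i ∈ S) := by
      constructor
      · rintro (h | h) i hi
        · rw [h]
        · simp [h, mem_symmDiff, hi]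
      · intro h
        by_cases hkk : k ∈ D ↔ k ∈ S
        · left
          ext i
          by_cases hi : i = k
          · rwa [hi]
          · exact h i hi
        · right
          ext i
          by_cases hi : i = k
          · subst hi
            simp only [mem_symmDiff, mem_singleton]
            tauto
          · simp [mem_symmDiff, hi, h i hi]
    rw [h1]
    constructor
    · intro h
      constructor
      · ext i
        by_cases hi : i ∈ Ico 1 k
        · rw [mem_Ico] at hi
          rw [← mem_descentSet_shufflePerm_left p hi.1 hi.2, ← hD, h i (by omega)]
          simp [hi]
        · have := mt (@descentSet_subset k p.2.1 i) hi
          simp only [mem_filter]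
          tauto
      · ext i
        by_cases hi : i ∈ Ico 1 m
        · rw [mem_Ico] at hi
          rw [← mem_descentSet_shufflePerm_right p hi.1 hi.2, ← hD, h (k + i) (by omega)]
          simp [hi]
        · have := mt (@descentSet_subset m p.2.2 i) hi
          simp only [mem_filter]
          tauto
    · rintro ⟨hl, hr⟩ i hik
      by_cases hi : i ∈ Ico 1 (k + m)
      · rw [mem_Ico] at hi
        rcases lt_or_gt_of_ne hik with hlt | hgt
        · rw [hD, mem_descentSet_shufflePerm_left p hi.1 hlt, hl]
          simp [hi.1, hlt]
        · obtain ⟨j, rfl⟩ := Nat.exists_eq_add_of_le hgt.le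
          rw [hD, mem_descentSet_shufflePerm_right p (by omega) (by omega), hr]
          simp only [mem_filter, mem_Ico]
          exact ⟨fun h => h.2, fun h => ⟨by omega, h⟩⟩
      · exact iff_of_false (mt (@descentSet_subset _ _ i) hi) (mt (@hS i) hi)
  have hleft : beta (k + m) S + beta (k + m) (symmDiff S {k}) =
      #{π : Equiv.Perm (Fin (k + m)) |
        descentSet (k + m) π = S ∨ descentSet (k + m) π = symmDiff S {k}} := by
    rw [filter_or, card_union_of_disjoint]
    · rfl
    · rw [disjoint_filter]
      intro π _ h1 h2
      exact hne (h2.symm.trans h1)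
  have hmid : #{π : Equiv.Perm (Fin (k + m)) |
        descentSet (k + m) π = S ∨ descentSet (k + m) π = symmDiff S {k}} =
      #((univ : Finset {A : Finset (Fin (k + m)) // A.card = k}) ×ˢ
        (univ.filter (fun σ : Equiv.Perm (Fin k) => descentSet k σ = {i ∈ Ico 1 k | i ∈ S}) ×ˢ
        univ.filter fun τ : Equiv.Perm (Fin m) =>
          descentSet m τ = {i ∈ Ico 1 m | k + i ∈ S})) := by
    symm
    refine card_bijective shufflePerm (shufflePerm_bijective k m) fun p => ?_
    simp only [mem_product, mem_filter, mem_univ, true_and]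
    exact (hkey p).symm
  rw [hleft, hmid, card_product, card_product, card_univ, Fintype.card_finset_len,
    Fintype.card_fin]
  rfl

theorem cast_beta_symmDiff {R : Type*} [Ring R] {n k : ℕ} (hk : k ∈ Ico 1 n) {S : Finset ℕ}
    (hS : S ⊆ Ico 1 n) : (beta n (symmDiff S {k}) : R) = (n.choose k : R) *
      (beta k {i ∈ Ico 1 k | i ∈ S} * beta (n - k) {i ∈ Ico 1 (n - k) | k + i ∈ S}) -
        beta n S := by
  obtain ⟨h1, h2⟩ := mem_Ico.1 hk
  obtain ⟨m, rfl⟩ := Nat.exists_eq_add_of_le h2.le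
  have := congrArg (Nat.cast : ℕ → R) (beta_add_beta_symmDiff (by omega) hS)
  push_cast at this
  rw [Nat.add_sub_cancel_left, ← this, add_sub_cancel_left]

theorem symmDiff_singleton_subset {α : Type*} [DecidableEq α] {S T : Finset α} {k : α}
    (hS : S ⊆ T) (hk : k ∈ T) : symmDiff S {k} ⊆ T :=
  symmDiff_le_sup.trans (union_subset hS (singleton_subset_iff.2 hk))

theorem choose_two_pow_add_two_pow (i j k : ℕ) : ((2 ^ i + 2 ^ j).choose k : ZMod 2) =
    (if k = 2 ^ i + 2 ^ j then 1 else 0) + (if k = 2 ^ i then 1 else 0) +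
      ((if k = 2 ^ j then 1 else 0) + if k = 0 then 1 else 0) := by
  rw [← coeff_X_add_one_pow, pow_add, add_pow_char_pow, add_pow_char_pow, one_pow, one_pow]
  rw [show (X ^ 2 ^ i + 1) * (X ^ 2 ^ j + 1) =
    (X ^ (2 ^ i + 2 ^ j) + X ^ 2 ^ i + (X ^ 2 ^ j + X ^ 0) : (ZMod 2)[X]) by ring]
  simp only [coeff_add, coeff_X_pow]

theorem choose_two_pow_add_two_pow_add_two_pow (i j l k : ℕ) :
    ((2 ^ i + 2 ^ j + 2 ^ l).choose k : ZMod 2) =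
    ((if k = 2 ^ i + 2 ^ j + 2 ^ l then 1 else 0) + (if k = 2 ^ i + 2 ^ j then 1 else 0) +
      ((if k = 2 ^ i + 2 ^ l then 1 else 0) + (if k = 2 ^ j + 2 ^ l then 1 else 0))) +
    ((if k = 2 ^ i then 1 else 0) + (if k = 2 ^ j then 1 else 0) +
      ((if k = 2 ^ l then 1 else 0) + if k = 0 then 1 else 0)) := by
  rw [← coeff_X_add_one_pow, pow_add, pow_add, add_pow_char_pow, add_pow_char_pow,
    add_pow_char_pow, one_pow, one_pow, one_pow]
  rw [show (X ^ 2 ^ i + 1) * (X ^ 2 ^ j + 1) * (X ^ 2 ^ l + 1) =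
    ((X ^ (2 ^ i + 2 ^ j + 2 ^ l) + X ^ (2 ^ i + 2 ^ j) + (X ^ (2 ^ i + 2 ^ l) +
      X ^ (2 ^ j + 2 ^ l))) + (X ^ 2 ^ i + X ^ 2 ^ j + (X ^ 2 ^ l + X ^ 0)) :
      (ZMod 2)[X]) by ring]
  simp only [coeff_add, coeff_X_pow]

theorem symmDiff_singleton_of_notMem {α : Type*} [DecidableEq α] {S : Finset α} {k : α}
    (hk : k ∉ S) : symmDiff S {k} = insert k S := by
  rw [(disjoint_singleton_right.2 hk).symmDiff_eq_sup, sup_eq_union, union_comm, insert_eq]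

theorem beta_two_pow (i : ℕ) {S : Finset ℕ} (hS : S ⊆ Ico 1 (2 ^ i)) :
    (beta (2 ^ i) S : ZMod 2) = 1 := by
  induction S using Finset.induction_on with
  | empty => simp [beta_empty]
  | insert k S hk ih =>
    rw [insert_subset_iff] at hS
    have hchoose : ((2 ^ i).choose k : ZMod 2) = 0 := by
      rw [ZMod.natCast_eq_zero_iff]
      have := mem_Ico.1 hS.1
      exact Nat.prime_two.dvd_choose_pow (by omega) (by omega)
    rw [← symmDiff_singleton_of_notMem hk, cast_beta_symmDiff hS.1 hS.2, hchoose, ih hS.2, zero_mul]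
    decide

theorem beta_two_pow_add_two_pow {i j : ℕ} (hij : i ≠ j) {S : Finset ℕ}
    (hS : S ⊆ Ico 1 (2 ^ i + 2 ^ j)) :
    (beta (2 ^ i + 2 ^ j) S : ZMod 2) =
      1 + (if 2 ^ i ∈ S then 1 else 0) + if 2 ^ j ∈ S then 1 else 0 := by
  have hne : 2 ^ i ≠ 2 ^ j := fun h => hij (Nat.pow_right_injective le_rfl h)
  induction S using Finset.induction_on with
  | empty => simp [beta_empty]
  | insert k S hk ih =>
    rw [insert_subset_iff] at hS
    obtain ⟨h1, h2⟩ := mem_Ico.1 hS.1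
    rw [← symmDiff_singleton_of_notMem hk, cast_beta_symmDiff hS.1 hS.2, ih hS.2,
      symmDiff_singleton_of_notMem hk, choose_two_pow_add_two_pow]
    by_cases hki : k = 2 ^ i
    · subst hki
      rw [Nat.add_sub_cancel_left, beta_two_pow _ (filter_subset _ _),
        beta_two_pow _ (filter_subset _ _)]
      simp only [hne, hne.symm, h2.ne, hk, mem_insert, false_or, if_true, if_false, true_or]
      rw [if_neg (by omega)]
      split_ifs <;> decide
    by_cases hkj : k = 2 ^ j
    · subst hkj
      rw [Nat.add_sub_cancel, beta_two_pow _ (filter_subset _ _),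
        beta_two_pow _ (filter_subset _ _)]
      simp only [hne, hne.symm, h2.ne, hk, mem_insert, false_or, if_true, if_false, true_or]
      rw [if_neg (by omega)]
      split_ifs <;> decide
    · simp only [mem_insert, Ne.symm hki, Ne.symm hkj, hki, hkj, h2.ne, false_or, if_false]
      rw [if_neg (by omega)]
      simp only [add_zero, zero_mul]
      split_ifs <;> decide

theorem two_pow_ne_two_pow_add_two_pow {i j l : ℕ} (hjl : j ≠ l) :
    2 ^ i ≠ 2 ^ j + 2 ^ l := by
  wlog h : j < l generalizing j l
  · rw [add_comm]
    exact this hjl.symm (by omega)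
  have hlt : 2 ^ j < 2 ^ l := Nat.pow_lt_pow_right (by omega) h
  intro heq
  have h1 : 2 ^ l < 2 ^ i := by have := Nat.pos_of_neZero (2 ^ j); omega
  have h2 : 2 ^ i < 2 ^ (l + 1) := by rw [pow_succ]; omega
  have h3 := (Nat.pow_lt_pow_iff_right (by omega)).1 h1
  have h4 := (Nat.pow_lt_pow_iff_right (by omega)).1 h2
  omega

theorem beta_symmDiff_two_pow {i j l n : ℕ} (hij : i ≠ j) (hil : i ≠ l) (hjl : j ≠ l)
    (hn : n = 2 ^ i + 2 ^ j + 2 ^ l) {S : Finset ℕ} (hS : S ⊆ Ico 1 n)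
    (h : 2 ^ i + 2 ^ j ∈ S ↔ 2 ^ i + 2 ^ l ∈ S) :
    (beta n (symmDiff S {2 ^ i}) : ZMod 2) = beta n S + 1 := by
  have hi := Nat.pos_of_neZero (2 ^ i)
  have hj := Nat.pos_of_neZero (2 ^ j)
  have hl := Nat.pos_of_neZero (2 ^ l)
  have h1 : 2 ^ i ≠ 2 ^ j := fun h => hij (Nat.pow_right_injective le_rfl h)
  have h2 : 2 ^ i ≠ 2 ^ l := fun h => hil (Nat.pow_right_injective le_rfl h)
  have h3 : 2 ^ i ≠ 2 ^ j + 2 ^ l := two_pow_ne_two_pow_add_two_pow hjl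
  rw [cast_beta_symmDiff (mem_Ico.2 ⟨hi, by omega⟩) hS,
    show n - 2 ^ i = 2 ^ j + 2 ^ l by omega, beta_two_pow _ (filter_subset _ _),
    beta_two_pow_add_two_pow hjl (filter_subset _ _), hn,
    choose_two_pow_add_two_pow_add_two_pow]
  rw [if_neg (by omega), if_neg (by omega), if_neg (by omega), if_neg h3, if_pos rfl, if_neg h1,
    if_neg h2, if_neg (by omega)]
  have h4 : 2 ^ j ∈ ({t ∈ Ico 1 (2 ^ j + 2 ^ l) | 2 ^ i + t ∈ S} : Finset ℕ) ↔
      2 ^ i + 2 ^ j ∈ S := by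
    simp only [mem_filter, mem_Ico]
    exact ⟨fun h => h.2, fun h => ⟨by omega, h⟩⟩
  have h5 : 2 ^ l ∈ ({t ∈ Ico 1 (2 ^ j + 2 ^ l) | 2 ^ i + t ∈ S} : Finset ℕ) ↔
      2 ^ i + 2 ^ j ∈ S := by
    simp only [mem_filter, mem_Ico]
    exact ⟨fun h' => h.2 h'.2, fun h' => ⟨by omega, h.1 h'⟩⟩
  simp only [h4, h5]
  generalize (beta _ S : ZMod 2) = x
  revert x
  split_ifs <;> decide

theorem pow_eq_neg_pow {K : Type*} [Field K] {ζ : K} {s x y : ℕ}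
    (hsodd : Odd s) (hζ : IsPrimitiveRoot ζ (2 * s))
    (hmod : (x : ZMod s) = y) (hpar : (x : ZMod 2) = y + 1) : ζ ^ x = -ζ ^ y := by
  have hs := hsodd.pos
  have hζs : ζ ^ s = -1 := by
    have h2 : IsPrimitiveRoot (ζ ^ s) 2 := hζ.pow (by omega) (by ring)
    exact h2.eq_neg_one_of_two_right
  wlog hle : y ≤ x generalizing x y
  · rw [this hmod.symm (by rw [hpar]; generalize (y : ZMod 2) = z; revert z; decide) (by omega),
      neg_neg]
  obtain ⟨d, rfl⟩ := Nat.exists_eq_add_of_le hle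
  push_cast at hmod hpar
  have hd : s ∣ d := by
    rw [← ZMod.natCast_eq_zero_iff]
    simpa using hmod
  obtain ⟨t, rfl⟩ := hd
  have hodd : Odd (s * t) := by
    rw [← ZMod.natCast_eq_one_iff_odd]
    exact_mod_cast add_left_cancel hpar
  rw [pow_add, pow_mul, hζs, (Nat.odd_mul.1 hodd).2.neg_one_pow]
  ring

theorem cyclotomic_dvd_Q_of_involution {n s : ℕ} (hsodd : Odd s) (φ : Finset ℕ → Finset ℕ)
    (hmem : ∀ S ⊆ Ico 1 n, φ S ⊆ Ico 1 n) (hinv : ∀ S ⊆ Ico 1 n, φ (φ S) = S)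
    (hmod : ∀ S ⊆ Ico 1 n, (beta n (φ S) : ZMod s) = beta n S)
    (hpar : ∀ S ⊆ Ico 1 n, (beta n (φ S) : ZMod 2) = beta n S + 1) :
    cyclotomic (2 * s) ℤ ∣ Q n := by
  have hpos : 0 < 2 * s := Nat.mul_pos two_pos hsodd.pos
  have hζ := Complex.isPrimitiveRoot_exp (2 * s) hpos.ne'
  rw [cyclotomic_eq_minpoly hζ hpos]
  refine minpoly.isIntegrallyClosed_dvd (hζ.isIntegral hpos) ?_
  simp only [Q, map_sum, map_pow, aeval_X]
  refine sum_involution (fun S _ => φ S) (fun S hS => ?_) (fun S hS _ heq => ?_)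
    (fun S hS => mem_powerset.2 (hmem S (mem_powerset.1 hS)))
    (fun S hS => hinv S (mem_powerset.1 hS))
  · have hS := mem_powerset.1 hS
    rw [pow_eq_neg_pow hsodd hζ (hmod S hS) (hpar S hS), add_neg_cancel]
  · have := hpar S (mem_powerset.1 hS)
    rw [heq, left_eq_add] at this
    exact one_ne_zero this

/-- A power of two among the binary digits `2 ^ a, 2 ^ b, 2 ^ c`, chosen so that `S` contains
both or neither of its sums with the other two digits. -/
def balancedDigit (a b c : ℕ) (S : Finset ℕ) : ℕ :=
  if 2 ^ a + 2 ^ b ∈ S ↔ 2 ^ a + 2 ^ c ∈ S then 2 ^ a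
  else if 2 ^ a + 2 ^ b ∈ S ↔ 2 ^ b + 2 ^ c ∈ S then 2 ^ b
  else 2 ^ c

theorem balancedDigit_eq_or (a b c : ℕ) (S : Finset ℕ) : balancedDigit a b c S = 2 ^ a ∨
    balancedDigit a b c S = 2 ^ b ∨ balancedDigit a b c S = 2 ^ c := by
  unfold balancedDigit
  split_ifs <;> simp

theorem beta_symmDiff_balancedDigit {a b c n : ℕ} (hab : a ≠ b) (hbc : b ≠ c) (hac : a ≠ c)
    (hn : n = 2 ^ c + 2 ^ b + 2 ^ a) {S : Finset ℕ} (hS : S ⊆ Ico 1 n) :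
    (beta n (symmDiff S {balancedDigit a b c S}) : ZMod 2) = beta n S + 1 := by
  unfold balancedDigit
  split_ifs with h1 h2
  · exact beta_symmDiff_two_pow hab hac hbc (by omega) hS h1
  · exact beta_symmDiff_two_pow hab.symm hbc hac (by omega) hS (by rwa [add_comm (2 ^ b) (2 ^ a)])
  · refine beta_symmDiff_two_pow hac.symm hbc.symm hab (by omega) hS ?_
    rw [add_comm (2 ^ c) (2 ^ a), add_comm (2 ^ c) (2 ^ b)]
    tauto

theorem beta_symmDiff_of_dvd_choose {n s k : ℕ} (hk : k ∈ Ico 1 n) (hsk : s ∣ n.choose k)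
    {S : Finset ℕ} (hS : S ⊆ Ico 1 n) :
    (beta n (symmDiff S {k}) : ZMod s) = -beta n S := by
  rw [cast_beta_symmDiff hk hS, (ZMod.natCast_eq_zero_iff _ _).2 hsk]
  simp

end

/-- For `n = 2^c + 2^b + 2^a` with `c > b > a ≥ 0` and `s` an odd positive
integer dividing `C(n,2^a)`, `C(n,2^b)` and `C(n,2^c)`, if moreover `s` divides
`C(n,k)` for some `1 ≤ k ≤ n-1` which is not one of the six essential elements
`2^a, 2^b, 2^a+2^b, 2^c, 2^c+2^a, 2^c+2^b`, then `Φ_{2s}` divides `Q_n(t)`. -/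
theorem cyclotomic_two_s_dvd_three_digits (a b c s k : ℕ)
    (hab : a < b) (hbc : b < c) (hs : 0 < s) (hsodd : Odd s)
    (hsa : s ∣ (2 ^ c + 2 ^ b + 2 ^ a).choose (2 ^ a))
    (hsb : s ∣ (2 ^ c + 2 ^ b + 2 ^ a).choose (2 ^ b))
    (hsc : s ∣ (2 ^ c + 2 ^ b + 2 ^ a).choose (2 ^ c))
    (hk1 : 1 ≤ k) (hk2 : k ≤ 2 ^ c + 2 ^ b + 2 ^ a - 1)
    (hknotin : k ∉ ({2 ^ a, 2 ^ b, 2 ^ a + 2 ^ b, 2 ^ c, 2 ^ c + 2 ^ a, 2 ^ c + 2 ^ b} : Finset ℕ))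
    (hk : s ∣ (2 ^ c + 2 ^ b + 2 ^ a).choose k) :
    Polynomial.cyclotomic (2 * s) ℤ ∣ Q (2 ^ c + 2 ^ b + 2 ^ a) := by
  have hpa := Nat.pos_of_neZero (2 ^ a)
  have hltab : 2 ^ a < 2 ^ b := Nat.pow_lt_pow_right (by omega) hab
  have hltbc : 2 ^ b < 2 ^ c := Nat.pow_lt_pow_right (by omega) hbc
  have hac : a ≠ c := by omega
  obtain ⟨n, hn⟩ : ∃ n, n = 2 ^ c + 2 ^ b + 2 ^ a := ⟨_, rfl⟩
  rw [← hn] at hsa hsb hsc hk2 hk ⊢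
  simp only [Finset.mem_insert, Finset.mem_singleton, not_or] at hknotin
  obtain ⟨hka, hkb, hkab, hkc, hkca, hkcb⟩ := hknotin
  have hkn : k ∈ Finset.Ico 1 n := Finset.mem_Ico.2 (by omega)
  have hdigit : ∀ S, balancedDigit a b c S ∈ Finset.Ico 1 n := fun S => by
    rw [Finset.mem_Ico]
    rcases balancedDigit_eq_or a b c S with h | h | h <;> omega
  have hdvd : ∀ S, s ∣ n.choose (balancedDigit a b c S) := fun S => by
    rcases balancedDigit_eq_or a b c S with h | h | h <;> rwa [h]
  have heven : 2 ∣ n.choose k := by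
    rw [← ZMod.natCast_eq_zero_iff, hn, choose_two_pow_add_two_pow_add_two_pow]
    repeat rw [if_neg (by omega)]
    rfl
  have hsub : ∀ S ⊆ Finset.Ico 1 n,
      symmDiff S {balancedDigit a b c S} ⊆ Finset.Ico 1 n := fun S hS =>
    symmDiff_singleton_subset hS (hdigit S)
  refine cyclotomic_dvd_Q_of_involution hsodd
    (fun S => symmDiff (symmDiff S {balancedDigit a b c S}) {k})
    (fun S hS => symmDiff_singleton_subset (hsub S hS) hkn) (fun S _ => ?_) (fun S hS => ?_)
    (fun S hS => ?_)
  · have hsame : ∀ y, y ≠ 2 ^ a → y ≠ 2 ^ b → y ≠ 2 ^ c → y ≠ k →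
        (y ∈ symmDiff (symmDiff S {balancedDigit a b c S}) {k} ↔ y ∈ S) := by
      intro y hya hyb hyc hyk
      have : y ≠ balancedDigit a b c S := by
        rcases balancedDigit_eq_or a b c S with h | h | h <;> rwa [h]
      simp [Finset.mem_symmDiff, this, hyk]
    have hfix : balancedDigit a b c (symmDiff (symmDiff S {balancedDigit a b c S}) {k}) =
        balancedDigit a b c S := by
      have h1 := hsame (2 ^ a + 2 ^ b) (by omega) (by omega)
        (two_pow_ne_two_pow_add_two_pow hab.ne).symm (by omega)
      have h2 := hsame (2 ^ a + 2 ^ c) (by omega) (by omega) (by omega) (by omega)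
      have h3 := hsame (2 ^ b + 2 ^ c) (by omega) (by omega) (by omega) (by omega)
      conv_rhs => rw [balancedDigit]
      rw [balancedDigit]
      simp only [h1, h2, h3]
    rw [hfix, symmDiff_right_comm _ ({k} : Finset ℕ), symmDiff_symmDiff_cancel_right,
      symmDiff_symmDiff_cancel_right]
  · rw [beta_symmDiff_of_dvd_choose hkn hk (hsub S hS),
      beta_symmDiff_of_dvd_choose (hdigit S) (hdvd S) hS, neg_neg]
  · rw [beta_symmDiff_of_dvd_choose hkn heven (hsub S hS), ZMod.neg_eq_self_mod_two,
      beta_symmDiff_balancedDigit hab.ne hbc.ne hac hn hS]
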